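/- Let p be a prime such that S is p-maximal, and let λ = (l,μ,m) ∈ L₀^# ∩ P_S with ν_λ := ν_p(gcd(S₀λ)) = ν_p(m). Put w_p := 1 + 2·ν_p(2·ℓ_λ·Q₀(λ)), where ℓ_λ is the level of λ. Then for every integer ν ≥ w_p: N*(λ, p^{ν+1}) = p^{n−1} · N*(λ, p^ν). -/

import Mathlib

open Matrix Complex

namespace OEis

/-- Extension of an even Gram matrix by a hyperbolic plane:
`[[0,0,1],[0,A,0],[1,0,0]]`. -/
def hyp {m : ℕ} (A : Matrix (Fin m) (Fin m) ℤ) :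
    Matrix (Fin (m + 2)) (Fin (m + 2)) ℤ := fun i j =>
  if hi0 : (i : ℕ) = 0 then (if (j : ℕ) = m + 1 then 1 else 0)
  else if him : (i : ℕ) = m + 1 then (if (j : ℕ) = 0 then 1 else 0)
  else if hj0 : (j : ℕ) = 0 then 0
  else if hjm : (j : ℕ) = m + 1 then 0
  else A ⟨(i : ℕ) - 1, by have := i.isLt; omega⟩ ⟨(j : ℕ) - 1, by have := j.isLt; omega⟩

variable (n : ℕ) (S : Matrix (Fin n) (Fin n) ℤ)

/-- `S₀ = [[0,0,1],[0,-S,0],[1,0,0]]`. -/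
def MatS0 : Matrix (Fin (n + 2)) (Fin (n + 2)) ℤ := hyp (-S)

/-- `S₁ = [[0,0,1],[0,S₀,0],[1,0,0]]`. -/
def MatS1 : Matrix (Fin (n + 4)) (Fin (n + 4)) ℤ := hyp (MatS0 n S)

/-- Bilinear form `uᵀ A v` over a field `K`. -/
def bilin {m : ℕ} (K : Type) [Field K] (A : Matrix (Fin m) (Fin m) ℤ)
    (u v : Fin m → K) : K :=
  u ⬝ᵥ (A.map (Int.cast : ℤ → K)).mulVec v

/-- Quadratic form `Q_A(v) = vᵀAv/2` over a field `K`. -/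
def quadF {m : ℕ} (K : Type) [Field K] (A : Matrix (Fin m) (Fin m) ℤ)
    (v : Fin m → K) : K := bilin K A v v / 2

/-- First component of a vector. -/
def vfirst {m : ℕ} {K : Type} (g : Fin (m + 2) → K) : K := g ⟨0, by omega⟩

/-- Last component of a vector. -/
def vlast {m : ℕ} {K : Type} (g : Fin (m + 2) → K) : K := g ⟨m + 1, by omega⟩

/-- Middle components of a vector. -/
def vmid {m : ℕ} {K : Type} (g : Fin (m + 2) → K) : Fin m → K :=
  fun i => g ⟨(i : ℕ) + 1, by have := i.isLt; omega⟩

/-- gcd of the entries of a rational vector (via numerators). -/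
def ratGcd {m : ℕ} (v : Fin m → ℚ) : ℕ :=
  Finset.gcd Finset.univ fun i => (v i).num.natAbs

/-- `v` has integral entries. -/
def inLat {m : ℕ} (v : Fin m → ℚ) : Prop := ∀ i, ∃ z : ℤ, v i = (z : ℚ)

/-- `g ∈ ℤ^m + c`. -/
def inLatShift {m : ℕ} (c g : Fin m → ℚ) : Prop := ∀ i, ∃ z : ℤ, g i - c i = (z : ℚ)

/-- Membership in the dual lattice `A⁻¹ℤ^m`, i.e. `Av` is integral. -/
def inDual {m : ℕ} (A : Matrix (Fin m) (Fin m) ℤ) (v : Fin m → ℚ) : Prop :=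
  ∀ i, ∃ z : ℤ, ((A.map (Int.cast : ℤ → ℚ)).mulVec v) i = (z : ℚ)

/-- The positive cone `P_S`. -/
def PosCone : Set (Fin (n + 2) → ℝ) :=
  {y | 0 < quadF ℝ (MatS0 n S) y ∧ 0 < y ⟨0, by omega⟩}

/-- The tube domain `H_S`. -/
def HS : Set (Fin (n + 2) → ℂ) :=
  {z | (fun i => (z i).im) ∈ PosCone n S}

/-- Automorphy factor attached to a vector:
`j(g,z) = -γ Q₀(z) + (d,z)₀ + δ` for `g = (δ,dᵀ,γ)ᵀ`. -/
noncomputable def jay (g : Fin (n + 4) → ℚ) (z : Fin (n + 2) → ℂ) : ℂ :=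
  -((vlast g : ℚ) : ℂ) * quadF ℂ (MatS0 n S) z
    + bilin ℂ (MatS0 n S) (fun i => ((vmid g i : ℚ) : ℂ)) z
    + ((vfirst g : ℚ) : ℂ)

/-- The index set of the Eisenstein series attached to a cusp `c`:
`{g ∈ L₁ + c : Q₁(g) = 0, gcd(S₁g) = 1}`. -/
def cuspSet (c : Fin (n + 4) → ℚ) : Set (Fin (n + 4) → ℚ) :=
  {g | inLatShift c g ∧ quadF ℚ (MatS1 n S) g = 0 ∧
    ratGcd (((MatS1 n S).map (Int.cast : ℤ → ℚ)).mulVec g) = 1}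

/-- The standard-form cusp vector `(1, 0, 𝔠ᵀ, 0, Q(𝔠))ᵀ`. -/
def stdCuspVec (fc : Fin n → ℚ) : Fin (n + 4) → ℚ := fun i =>
  if h0 : (i : ℕ) = 0 then 1
  else if h3 : (i : ℕ) = n + 3 then quadF ℚ S fc
  else if h12 : (i : ℕ) = 1 ∨ (i : ℕ) = n + 2 then 0
  else fc ⟨(i : ℕ) - 2, by have := i.isLt; omega⟩

/-- `c` is a standard-form cusp. -/
def IsStdCusp (c : Fin (n + 4) → ℚ) : Prop :=
  ∃ fc : Fin n → ℚ, inDual S fc ∧ (∃ z : ℤ, quadF ℚ S fc = (z : ℚ)) ∧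
    c = stdCuspVec n S fc

/-- The real orthogonal group of `A`. -/
def OSet {m : ℕ} (A : Matrix (Fin m) (Fin m) ℤ) : Set (Matrix (Fin m) (Fin m) ℝ) :=
  {M | Mᵀ * A.map (Int.cast : ℤ → ℝ) * M = A.map (Int.cast : ℤ → ℝ)}

/-- Connected component of the identity in the real orthogonal group. -/
def OPlus {m : ℕ} (A : Matrix (Fin m) (Fin m) ℤ) : Set (Matrix (Fin m) (Fin m) ℝ) :=
  connectedComponentIn (OSet A) 1

/-- `Γ_S`: integral matrices in `O⁺(S₁;ℝ)`. -/
def GammaS : Set (Matrix (Fin (n + 4)) (Fin (n + 4)) ℝ) :=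
  {M | M ∈ OPlus (MatS1 n S) ∧ ∀ i j, ∃ z : ℤ, M i j = (z : ℝ)}

/-- The discriminant kernel `Γ̃_S`. -/
def GammaTilde : Set (Matrix (Fin (n + 4)) (Fin (n + 4)) ℝ) :=
  {M | M ∈ GammaS n S ∧
    ∃ X : Matrix (Fin (n + 4)) (Fin (n + 4)) ℤ,
      M = 1 + (X * MatS1 n S).map (Int.cast : ℤ → ℝ)}

/-- Automorphy factor of a matrix: `j(M,z) = -γ Q₀(z) + (d,z)₀ + δ`
where `(γ, dᵀS₀, δ)` is the bottom row of `M`. -/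
noncomputable def jayM (M : Matrix (Fin (n + 4)) (Fin (n + 4)) ℝ)
    (z : Fin (n + 2) → ℂ) : ℂ :=
  -((M ⟨n + 3, by omega⟩ ⟨0, by omega⟩ : ℝ) : ℂ) * quadF ℂ (MatS0 n S) z
    + ∑ i : Fin (n + 2),
        ((M ⟨n + 3, by omega⟩ ⟨(i : ℕ) + 1, by have := i.isLt; omega⟩ : ℝ) : ℂ) * z i
    + ((M ⟨n + 3, by omega⟩ ⟨n + 3, by omega⟩ : ℝ) : ℂ)

/-- The action `M⟨z⟩ = (-Q₀(z)·b + Kz + c')·j(M,z)⁻¹`. -/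
noncomputable def actM (M : Matrix (Fin (n + 4)) (Fin (n + 4)) ℝ)
    (z : Fin (n + 2) → ℂ) : Fin (n + 2) → ℂ := fun i =>
  (-(quadF ℂ (MatS0 n S) z) *
      ((M ⟨(i : ℕ) + 1, by have := i.isLt; omega⟩ ⟨0, by omega⟩ : ℝ) : ℂ)
    + ∑ j : Fin (n + 2),
        ((M ⟨(i : ℕ) + 1, by have := i.isLt; omega⟩
            ⟨(j : ℕ) + 1, by have := j.isLt; omega⟩ : ℝ) : ℂ) * z j
    + ((M ⟨(i : ℕ) + 1, by have := i.isLt; omega⟩ ⟨n + 3, by omega⟩ : ℝ) : ℂ))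
  * (jayM n S M z)⁻¹

/-- The integral vector `(−Q₀(d)/γ, dᵀ, γ)ᵀ` built from `d` and `γ`. -/
def gExt (d : Fin (n + 2) → ℕ) (γ : ℕ) : Fin (n + 4) → ℚ := fun i =>
  if h0 : (i : ℕ) = 0 then -(quadF ℚ (MatS0 n S) fun j => (d j : ℚ)) / γ
  else if h3 : (i : ℕ) = n + 3 then (γ : ℚ)
  else (d ⟨(i : ℕ) - 1, by have := i.isLt; omega⟩ : ℚ)

open scoped Classical in
/-- The Dirichlet coefficient `a(λ,γ)`. -/
noncomputable def aCoef (lam : Fin (n + 2) → ℚ) (γ : ℕ) : ℂ :=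
  ∑ d ∈ Fintype.piFinset fun _ : Fin (n + 2) => Finset.range γ,
    if (∃ e : ℤ, quadF ℚ (MatS0 n S) (fun j => (d j : ℚ)) = (γ : ℚ) * e) ∧
        ratGcd (((MatS1 n S).map (Int.cast : ℤ → ℚ)).mulVec (gExt n S d γ)) = 1 then
      Complex.exp (2 * Real.pi * Complex.I *
        ((bilin ℚ (MatS0 n S) lam (fun j => (d j : ℚ)) / γ : ℚ) : ℂ))
    else 0

/-- The convolution `b(λ,γ) = Σ_{δ∣γ} a(λ,δ)`. -/
noncomputable def bCoef (lam : Fin (n + 2) → ℚ) (γ : ℕ) : ℂ :=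
  ∑ δ ∈ γ.divisors, aCoef n S lam δ

/-- The order/level of a rational vector: least `N ≥ 1` with `Nv` integral. -/
noncomputable def ordv {m : ℕ} (v : Fin m → ℚ) : ℕ :=
  sInf {N : ℕ | 0 < N ∧ ∀ i, ∃ z : ℤ, (N : ℚ) * v i = (z : ℚ)}

/-- `S` is `p`-maximal. -/
def pMaximal (p : ℕ) : Prop :=
  ∀ v : Fin n → ℚ, inDual S v → (∃ z : ℤ, quadF ℚ S v = (z : ℚ)) → ¬ p ∣ ordv v

/-- The vector `(l, μᵀ, m)ᵀ ∈ ℚ^{n+2}`. -/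
def asmVec (l : ℚ) (μ : Fin n → ℚ) (m : ℚ) : Fin (n + 2) → ℚ := fun i =>
  if h0 : (i : ℕ) = 0 then l
  else if h1 : (i : ℕ) = n + 1 then m
  else μ ⟨(i : ℕ) - 1, by have := i.isLt; omega⟩

open scoped Classical in
/-- The representation number `N(λ, p^ν, p^t)`. -/
noncomputable def Ncount (lam : Fin (n + 2) → ℚ) (p νl ν t : ℕ) : ℕ :=
  ((Fintype.piFinset fun _ : Fin n => Finset.range (p ^ ν)).filter fun v =>
    (∃ e : ℤ, quadF ℚ S (fun i => (v i : ℚ)) = (p : ℚ) ^ (t : ℕ) * e) ∧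
    (∃ e : ℤ, (p : ℚ) ^ ((νl : ℤ) - (t : ℤ)) * quadF ℚ S (fun i => (v i : ℚ))
        - bilin ℚ S (fun i => (v i : ℚ)) (vmid lam)
        + (p : ℚ) ^ ((t : ℤ) - (νl : ℤ)) * lam ⟨0, by omega⟩ * lam ⟨n + 1, by omega⟩
      = (p : ℚ) ^ (ν : ℕ) * e)).card

/-- `N*(λ,p^ν) = Σ_{t=0}^{min(ν,ν_λ)} N(λ,p^ν,p^t)`. -/
noncomputable def Nstar (lam : Fin (n + 2) → ℚ) (p νl ν : ℕ) : ℕ :=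
  ∑ t ∈ Finset.range (min ν νl + 1), Ncount n S lam p νl ν t

/-- Kloosterman sum `K(α,β;γ)` (with `β` allowed rational;
in all uses `β` is an integer). -/
noncomputable def kloos (α : ℤ) (β : ℚ) (γ : ℕ) : ℂ :=
  ∑ j ∈ Finset.range γ,
    if Nat.Coprime j γ then
      Complex.exp (2 * Real.pi * Complex.I *
        ((((α : ℚ) * j + β * ((((j : ZMod γ)⁻¹).val : ℕ) : ℚ)) / γ : ℚ) : ℂ))
    else 0

/-- `q ≡ 0 (mod p^k)` in `ℤ_p`, for a rational `q`. -/
def pCong (p k : ℕ) (q : ℚ) : Prop :=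
  q = 0 ∨ (k : ℤ) ≤ padicValRat p q

/-- The constant `c_{k,S}^• = (2π)^{2k-n/2}/(√(det S)·Γ(k)·Γ(k-n/2))`. -/
noncomputable def ckS (k : ℕ) : ℝ :=
  (2 * Real.pi) ^ ((2 * k : ℝ) - n / 2) /
    (Real.sqrt ((S.det : ℤ) : ℝ) * Real.Gamma (k : ℝ) * Real.Gamma ((k : ℝ) - n / 2))

end OEis

open OEis

/-- If an injective self-map `σ` of a finite set `X` raises `f` by `e`, where `f` takes values in
the multiples of `e`, then `f` is equidistributed on the multiples of `e`. -/
theorem card_eq_addOrderOf_mul_card_fiber {V R : Type*} [DecidableEq R] [AddCommGroup R]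
    (X : Finset V) (f : V → R) (e : R) (he : 0 < addOrderOf e) (σ : V → V)
    (hmaps : ∀ v ∈ X, σ v ∈ X) (hinj : Set.InjOn σ X) (hσ : ∀ v ∈ X, f (σ v) = f v + e)
    (hf : ∀ v ∈ X, ∃ c : ℕ, f v = c • e) :
    X.card = addOrderOf e * (X.filter fun v => f v = 0).card := by
  set N : ℕ → ℕ := fun c => (X.filter fun v => f v = c • e).card with hN
  have hmono : Monotone N := by
    refine monotone_nat_of_le_succ fun c => ?_
    refine Finset.card_le_card_of_injOn σ ?_ ?_
    · intro v hv
      simp only [Finset.coe_filter, Set.mem_ofPred_eq] at hv ⊢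
      exact ⟨hmaps v hv.1, by rw [hσ v hv.1, hv.2, succ_nsmul]⟩
    · exact hinj.mono fun v hv => (Finset.mem_filter.1 hv).1
  have hper : N (addOrderOf e) = N 0 := by simp [hN, addOrderOf_nsmul_eq_zero]
  have hconst : ∀ c ∈ Finset.range (addOrderOf e), N c = N 0 := fun c hc =>
    le_antisymm (hper ▸ hmono (Finset.mem_range.1 hc).le) (hmono (Nat.zero_le c))
  have hinj' : Set.InjOn (fun c : ℕ => c • e) (Finset.range (addOrderOf e)) := by
    simpa using nsmul_injOn_Iio_addOrderOf (x := e)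
  rw [Finset.card_eq_sum_card_fiberwise (f := f)
    (t := (Finset.range (addOrderOf e)).image fun c : ℕ => c • e), Finset.sum_image hinj',
    Finset.sum_congr rfl hconst]
  · simp [hN]
  · intro v hv
    obtain ⟨c, hc⟩ := hf v hv
    simp only [Finset.coe_image, Set.mem_image, Finset.mem_coe, Finset.mem_range]
    exact ⟨c % addOrderOf e, Nat.mod_lt _ he, by rw [hc, mod_addOrderOf_nsmul]⟩

/-- Polarization of the quadratic form `v ↦ vᵀTv`. -/
theorem dotProduct_mulVec_add_smul {R ι : Type*} [CommRing R] [Fintype ι] (T : Matrix ι ι R)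
    (v z : ι → R) (c : R) :
    (v + c • z) ⬝ᵥ T *ᵥ (v + c • z)
      = v ⬝ᵥ T *ᵥ v + c * (z ⬝ᵥ (T + Tᵀ) *ᵥ v) + c * c * (z ⬝ᵥ T *ᵥ z) := by
  have h : z ⬝ᵥ Tᵀ *ᵥ v = v ⬝ᵥ T *ᵥ z := by
    rw [mulVec_transpose, dotProduct_comm, ← dotProduct_mulVec]
  simp only [mulVec_add, mulVec_smul, add_mulVec, dotProduct_add, add_dotProduct,
    smul_dotProduct, dotProduct_smul, smul_eq_mul, h]
  ring

/-- A nonzero residue modulo `p ^ (ν + 1)` divides `p ^ ν`. -/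
theorem ZMod.dvd_prime_pow_of_ne_zero {p : ℕ} (hp : p.Prime) {ν : ℕ} {x : ZMod (p ^ (ν + 1))}
    (hx : x ≠ 0) : x ∣ (p : ZMod (p ^ (ν + 1))) ^ ν := by
  have : NeZero (p ^ (ν + 1)) := ⟨pow_ne_zero _ hp.ne_zero⟩
  obtain ⟨j, hj, hg⟩ := (Nat.dvd_prime_pow hp).1 (Nat.gcd_dvd_right x.val (p ^ (ν + 1)))
  have hjν : j ≤ ν := by
    by_contra! h
    have hj' : j = ν + 1 := by omega
    have hdvd : p ^ (ν + 1) ∣ x.val := (hg.trans (by rw [hj'])).symm.dvd.trans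
      (Nat.gcd_dvd_left x.val (p ^ (ν + 1)))
    exact hx ((ZMod.val_eq_zero x).1 (Nat.eq_zero_of_dvd_of_lt hdvd (ZMod.val_lt x)))
  have hbez := Nat.gcd_eq_gcd_ab x.val (p ^ (ν + 1))
  rw [hg] at hbez
  have hz := congrArg (Int.cast : ℤ → ZMod (p ^ (ν + 1))) hbez
  have h0 : (p : ZMod (p ^ (ν + 1))) ^ (ν + 1) = 0 := by
    exact_mod_cast ZMod.natCast_self (p ^ (ν + 1))
  push_cast at hz
  rw [ZMod.natCast_zmod_val, h0, zero_mul, add_zero] at hz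
  exact (Dvd.intro _ hz.symm).trans (pow_dvd_pow _ hjν)

theorem ZMod.pow_dvd_intCast_iff {p k j : ℕ} (hj : j ≤ k) (z : ℤ) :
    (p : ZMod (p ^ k)) ^ j ∣ (z : ZMod (p ^ k)) ↔ (p : ℤ) ^ j ∣ z := by
  constructor
  · rintro ⟨c, hc⟩
    obtain ⟨c', rfl⟩ := ZMod.intCast_surjective c
    have h : ((z - p ^ j * c' : ℤ) : ZMod (p ^ k)) = 0 := by push_cast; rw [hc, sub_self]
    rw [ZMod.intCast_zmod_eq_zero_iff_dvd] at h
    push_cast at h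
    have h' := ((pow_dvd_pow (p : ℤ) hj).trans h).add (Dvd.intro c' rfl : (p : ℤ) ^ j ∣ p ^ j * c')
    simpa using h'
  · intro h
    simpa using map_dvd (Int.castRingHom (ZMod (p ^ k))) h

theorem addOrderOf_prime_pow_zmod {p : ℕ} (hp : p.Prime) (ν : ℕ) :
    addOrderOf ((p : ZMod (p ^ (ν + 1))) ^ ν) = p := by
  have := Fact.mk hp
  refine addOrderOf_eq_prime ?_ ?_
  · rw [nsmul_eq_mul, ← pow_succ']
    exact_mod_cast ZMod.natCast_self (p ^ (ν + 1))
  · intro h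
    have h' : ((p ^ ν : ℕ) : ZMod (p ^ (ν + 1))) = 0 := by exact_mod_cast h
    rw [ZMod.natCast_eq_zero_iff, Nat.pow_dvd_pow_iff_le_right hp.one_lt] at h'
    omega

open scoped Classical in
/-- A Hensel type count: for `f v = a vᵀTv - b·v + d`, zeros of `f` modulo `p ^ ν` split evenly
among the multiples of `p ^ ν` in a quotient `R` of `ℤ` with `p ^ (ν + 1) = 0`, as long as the discriminant `D` of `f` has `p`-adic
valuation at most `r` with `2 * r < ν`. -/
theorem card_quadratic_fiber {R : Type*} [CommRing R] [Fintype R]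
    {n p ν r t : ℕ} (hp : 0 < p) (hp0 : (p : R) ^ (ν + 1) = 0)
    (hord : addOrderOf ((p : R) ^ ν) = p) (hdvd : ∀ x : R, x ≠ 0 → x ∣ (p : R) ^ ν)
    (hcast : Function.Surjective (Nat.cast : ℕ → R)) (hν : 2 * r + 1 ≤ ν)
    (ht : t ≤ r) (T : Matrix (Fin n) (Fin n) (R))
    (b y : Fin n → R) (a d ℓ D : R)
    (hy : (T + Tᵀ) *ᵥ y = ℓ • b) (hD : D = 2 * ℓ * a * d - y ⬝ᵥ b)
    (hDr : (p : R) ^ (ν - r) * D ≠ 0) :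
    (Finset.univ.filter fun v : Fin n → R =>
        (p : R) ^ t ∣ v ⬝ᵥ T *ᵥ v ∧
        (p : R) ^ ν ∣ a * (v ⬝ᵥ T *ᵥ v) - v ⬝ᵥ b + d).card
      = p * (Finset.univ.filter fun v : Fin n → R =>
        (p : R) ^ t ∣ v ⬝ᵥ T *ᵥ v ∧
        a * (v ⬝ᵥ T *ᵥ v) - v ⬝ᵥ b + d = 0).card := by
  set f : (Fin n → R) → R := fun v => a * (v ⬝ᵥ T *ᵥ v) - v ⬝ᵥ b + d with hf
  set X := Finset.univ.filter fun v : Fin n → R => (p : R) ^ t ∣ v ⬝ᵥ T *ᵥ v ∧ (p : R) ^ ν ∣ f v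
    with hX
  set P : R := (p : R) ^ (ν - r) with hP
  have hPP : P * P = 0 := by rw [hP, ← pow_add]; exact pow_eq_zero_of_le (by omega) hp0
  set g : (Fin n → R) → Fin n → R := fun v => a • (T + Tᵀ) *ᵥ v - b with hg
  have hsymm : ∀ u v : Fin n → R, u ⬝ᵥ (T + Tᵀ) *ᵥ v = v ⬝ᵥ (T + Tᵀ) *ᵥ u := fun u v => by
    rw [dotProduct_mulVec, dotProduct_comm, ← mulVec_transpose, transpose_add,
      transpose_transpose, add_comm]
  have hdiag : ∀ v : Fin n → R, v ⬝ᵥ (T + Tᵀ) *ᵥ v = 2 * (v ⬝ᵥ T *ᵥ v) := fun v => by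
    rw [add_mulVec, dotProduct_add, mulVec_transpose, dotProduct_comm v (v ᵥ* T),
      ← dotProduct_mulVec]
    ring
  have hdisc : ∀ v, ((a * ℓ) • v - y) ⬝ᵥ g v = 2 * ℓ * a * f v - D := fun v => by
    have h1 : y ⬝ᵥ (T + Tᵀ) *ᵥ v = ℓ * (v ⬝ᵥ b) := by
      rw [hsymm, hy, dotProduct_smul, smul_eq_mul]
    simp only [hg, hf, hD, sub_dotProduct, dotProduct_sub, smul_dotProduct, dotProduct_smul,
      smul_eq_mul, hdiag, h1]
    ring
  have hne : ∀ v ∈ X, P • g v ≠ 0 := by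
    intro v hv h0
    obtain ⟨c, hc⟩ := (Finset.mem_filter.1 hv).2.2
    have h1 : P * (((a * ℓ) • v - y) ⬝ᵥ g v) = 0 := by
      rw [← smul_eq_mul, ← dotProduct_smul, h0, dotProduct_zero]
    have h2 : P * (p : R) ^ ν = 0 := by rw [hP, ← pow_add]; exact pow_eq_zero_of_le (by omega) hp0
    rw [hdisc, hc] at h1
    apply hDr
    linear_combination -h1 + 2 * ℓ * a * c * h2
  have hz : ∀ h : Fin n → R, ∃ z : Fin n → R, h ≠ 0 → z ⬝ᵥ h = (p : R) ^ ν := by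
    intro h
    by_cases h0 : h = 0
    · exact ⟨0, fun H => (H h0).elim⟩
    · obtain ⟨i, hi⟩ := Function.ne_iff.1 h0
      obtain ⟨c, hc⟩ := hdvd _ hi
      exact ⟨Pi.single i c, fun _ => by rw [single_dotProduct, hc, mul_comm]⟩
  choose z hz using hz
  set σ : (Fin n → R) → Fin n → R := fun v => v + P • z (P • g v) with hσ
  have hgσ : ∀ v, P • g (σ v) = P • g v := fun v => by
    simp only [hg, hσ, mulVec_add, mulVec_smul, smul_sub, smul_add, smul_smul]
    rw [show P * (a * P) = a * (P * P) by ring, hPP]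
    simp
  have hfσ : ∀ v ∈ X, f (σ v) = f v + (p : R) ^ ν := fun v hv => by
    have h1 := hz _ (hne v hv)
    rw [← h1]
    simp only [hf, hσ, dotProduct_mulVec_add_smul]
    simp only [hPP, add_dotProduct, smul_dotProduct, dotProduct_smul, smul_eq_mul, zero_mul,
      add_zero]
    have h2 : ∀ u : Fin n → R, u ⬝ᵥ g v = a * (u ⬝ᵥ (T + Tᵀ) *ᵥ v) - u ⬝ᵥ b := fun u => by
      simp only [hg, dotProduct_sub, dotProduct_smul, smul_eq_mul]
    rw [h2]
    ring
  have key := card_eq_addOrderOf_mul_card_fiber X f ((p : R) ^ ν)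
    (by rwa [hord]) σ ?_ ?_ hfσ ?_
  · rw [hord] at key
    rw [key]
    congr 2
    ext v
    simp only [hX, Finset.mem_filter, Finset.mem_univ, true_and]
    exact ⟨fun h => ⟨h.1.1, h.2⟩, fun h => ⟨⟨h.1, (dvd_zero _).trans (Eq.symm h.2).dvd⟩, h.2⟩⟩
  · intro v hv
    have hfv := hfσ v hv
    obtain ⟨h1, h2⟩ := (Finset.mem_filter.1 hv).2
    refine Finset.mem_filter.2 ⟨Finset.mem_univ _, ?_, hfv ▸ dvd_add h2 dvd_rfl⟩
    simp only [hσ, dotProduct_mulVec_add_smul, hPP, zero_mul, add_zero]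
    exact dvd_add h1 (Dvd.dvd.mul_right (pow_dvd_pow _ (by omega)) _)
  · intro v _ w _ h
    have h1 : P • g v = P • g w := by rw [← hgσ v, ← hgσ w, h]
    simpa only [hσ, h1, add_left_inj] using h
  · intro v hv
    obtain ⟨c, hc⟩ := (Finset.mem_filter.1 hv).2.2
    obtain ⟨k, rfl⟩ := hcast c
    exact ⟨k, by rw [hc, nsmul_eq_mul, mul_comm]⟩

open scoped Classical in
/-- An `M`-periodic predicate holds `p ^ n` times as often on a box of side `M * p` as on a box
of side `M`. -/
theorem card_filter_box_mul {n M p : ℕ} (hM : 0 < M) (A : (Fin n → ℕ) → Prop)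
    (hA : ∀ v, A (fun i => v i % M) ↔ A v) :
    ((Fintype.piFinset fun _ : Fin n => Finset.range (M * p)).filter A).card
      = p ^ n * ((Fintype.piFinset fun _ : Fin n => Finset.range M).filter A).card := by
  have hbox : p ^ n = (Fintype.piFinset fun _ : Fin n => Finset.range p).card := by simp
  rw [hbox, ← Finset.card_product]
  refine Finset.card_bij' (fun v _ => (fun i => v i / M, fun i => v i % M))
    (fun w _ i => w.2 i + M * w.1 i) ?_ ?_ ?_ ?_
  · intro v hv
    simp only [Finset.mem_filter, Fintype.mem_piFinset, Finset.mem_range, Finset.mem_product]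
      at hv ⊢
    exact ⟨fun i => Nat.div_lt_of_lt_mul (hv.1 i), fun i => Nat.mod_lt _ hM, (hA v).2 hv.2⟩
  · intro w hw
    simp only [Finset.mem_filter, Fintype.mem_piFinset, Finset.mem_range, Finset.mem_product]
      at hw ⊢
    refine ⟨fun i => ?_, (hA _).1 ?_⟩
    · have h1 := hw.1 i
      have h2 := hw.2.1 i
      nlinarith
    · convert hw.2.2 using 2 with i
      rw [Nat.add_mul_mod_self_left, Nat.mod_eq_of_lt (hw.2.1 i)]
  · intro v _
    ext i
    exact Nat.mod_add_div _ _
  · intro w hw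
    simp only [Finset.mem_filter, Fintype.mem_piFinset, Finset.mem_range, Finset.mem_product]
      at hw
    refine Prod.ext (funext fun i => ?_) (funext fun i => ?_)
    · simp only
      rw [Nat.add_mul_div_left _ _ hM, Nat.div_eq_of_lt (hw.2.1 i), zero_add]
    · simp only
      rw [Nat.add_mul_mod_self_left, Nat.mod_eq_of_lt (hw.2.1 i)]

theorem card_filter_box_eq_card_zmod {n M : ℕ} [NeZero M] (A : (Fin n → ZMod M) → Prop)
    [DecidablePred A] :
    ((Fintype.piFinset fun _ : Fin n => Finset.range M).filter
        fun v => A fun i => (v i : ZMod M)).card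
      = (Finset.univ.filter A).card := by
  refine Finset.card_bij' (fun v _ i => (v i : ZMod M)) (fun w _ i => (w i).val) ?_ ?_ ?_ ?_
  · intro v hv
    simpa using (Finset.mem_filter.1 hv).2
  · intro w hw
    simp only [Finset.mem_filter, Fintype.mem_piFinset, Finset.mem_range, ZMod.natCast_zmod_val]
    exact ⟨fun i => ZMod.val_lt _, (Finset.mem_filter.1 hw).2⟩
  · intro v hv
    simp only [Finset.mem_filter, Fintype.mem_piFinset, Finset.mem_range] at hv
    ext i
    exact ZMod.val_cast_of_lt (hv.1 i)
  · intro w _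
    ext i
    simp

open scoped Classical in
/-- Integral form of `card_quadratic_fiber`, counting on boxes. -/
theorem card_box_quadratic_succ {n p ν r t : ℕ} (hn : 1 ≤ n) (hp : p.Prime) (hν : 2 * r + 1 ≤ ν)
    (ht : t ≤ r) (T : Matrix (Fin n) (Fin n) ℤ) (b y : Fin n → ℤ) (a d ℓ D : ℤ)
    (hy : (T + Tᵀ) *ᵥ y = ℓ • b) (hD : D = 2 * ℓ * a * d - y ⬝ᵥ b)
    (hDr : ¬ (p : ℤ) ^ (r + 1) ∣ D) (C : ℕ → (Fin n → ℕ) → Prop)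
    (hC : ∀ k v, C k v ↔
      (p : ℤ) ^ t ∣ (fun i => (v i : ℤ)) ⬝ᵥ T *ᵥ (fun i => (v i : ℤ)) ∧
      (p : ℤ) ^ k ∣ a * ((fun i => (v i : ℤ)) ⬝ᵥ T *ᵥ (fun i => (v i : ℤ)))
        - (fun i => (v i : ℤ)) ⬝ᵥ b + d) :
    ((Fintype.piFinset fun _ : Fin n => Finset.range (p ^ (ν + 1))).filter (C (ν + 1))).card
      = p ^ (n - 1) *
        ((Fintype.piFinset fun _ : Fin n => Finset.range (p ^ ν)).filter (C ν)).card := by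
  have : NeZero (p ^ (ν + 1)) := ⟨pow_ne_zero _ hp.ne_zero⟩
  set T' : Matrix (Fin n) (Fin n) (ZMod (p ^ (ν + 1))) := T.map Int.cast with hT'
  set b' : Fin n → ZMod (p ^ (ν + 1)) := fun i => b i with hb'
  set y' : Fin n → ZMod (p ^ (ν + 1)) := fun i => y i with hy'
  have hq : ∀ v : Fin n → ℕ,
      (((fun i => (v i : ℤ)) ⬝ᵥ T *ᵥ (fun i => (v i : ℤ)) : ℤ) : ZMod (p ^ (ν + 1)))
        = (fun i => (v i : ZMod (p ^ (ν + 1)))) ⬝ᵥ T' *ᵥ fun i => (v i : ZMod (p ^ (ν + 1))) := fun v => by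
    simp [dotProduct, mulVec, hT']
  have hl : ∀ v : Fin n → ℕ, (((fun i => (v i : ℤ)) ⬝ᵥ b : ℤ) : ZMod (p ^ (ν + 1)))
        = (fun i => (v i : ZMod (p ^ (ν + 1)))) ⬝ᵥ b' := fun v => by
    simp [dotProduct, hb']
  have hCR : ∀ k ≤ ν + 1, ∀ v, C k v ↔
      (p : ZMod (p ^ (ν + 1))) ^ t ∣ (fun i => (v i : ZMod (p ^ (ν + 1)))) ⬝ᵥ T' *ᵥ (fun i => (v i : ZMod (p ^ (ν + 1)))) ∧
      (p : ZMod (p ^ (ν + 1))) ^ k ∣ (a : ZMod (p ^ (ν + 1))) * ((fun i => (v i : ZMod (p ^ (ν + 1)))) ⬝ᵥ T' *ᵥ (fun i => (v i : ZMod (p ^ (ν + 1)))))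
        - (fun i => (v i : ZMod (p ^ (ν + 1)))) ⬝ᵥ b' + (d : ZMod (p ^ (ν + 1))) := fun k hk v => by
    rw [hC, ← ZMod.pow_dvd_intCast_iff (k := ν + 1) (show t ≤ ν + 1 by omega),
      ← ZMod.pow_dvd_intCast_iff (k := ν + 1) hk, ← hq, ← hl]
    push_cast
    rfl
  have hzero : (p : ZMod (p ^ (ν + 1))) ^ (ν + 1) = 0 := by exact_mod_cast ZMod.natCast_self (p ^ (ν + 1))
  have hmain := card_quadratic_fiber hp.pos hzero (addOrderOf_prime_pow_zmod hp ν)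
    (fun _ => ZMod.dvd_prime_pow_of_ne_zero hp) (fun x => ⟨x.val, ZMod.natCast_zmod_val x⟩) hν ht T' b' y' (a : ZMod (p ^ (ν + 1))) d ℓ D ?_ ?_ ?_
  · have h1 : ((Fintype.piFinset fun _ : Fin n => Finset.range (p ^ (ν + 1))).filter
        (C ν)).card = p * ((Fintype.piFinset fun _ : Fin n =>
          Finset.range (p ^ (ν + 1))).filter (C (ν + 1))).card := by
      rw [← card_filter_box_eq_card_zmod, ← card_filter_box_eq_card_zmod] at hmain
      convert hmain using 3
      · exact hCR ν (by omega) _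
      · congr 1
        ext v
        rw [hCR (ν + 1) le_rfl, hzero, zero_dvd_iff]
    have h2 := card_filter_box_mul (p := p) (pow_pos hp.pos ν) (C ν) fun v => ?_
    · rw [← pow_succ, h1] at h2
      obtain ⟨n, rfl⟩ : ∃ k, n = k + 1 := ⟨n - 1, by omega⟩
      rw [pow_succ' p n, mul_assoc] at h2
      exact Nat.eq_of_mul_eq_mul_left hp.pos h2
    · have hmod : ∀ i, ∃ c : ℤ, ((v i % p ^ ν : ℕ) : ℤ) = (v i : ℤ) + (p : ℤ) ^ ν * c := fun i =>
        ⟨-(v i / p ^ ν : ℕ), by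
          have := Nat.mod_add_div (v i) (p ^ ν)
          zify at this ⊢
          linarith⟩
      choose c hc using hmod
      have hvec : (fun i => ((v i % p ^ ν : ℕ) : ℤ)) = (fun i => (v i : ℤ)) + (p : ℤ) ^ ν • c := by
        ext i; simp [hc]
      rw [hC, hC, hvec, dotProduct_mulVec_add_smul, add_dotProduct, smul_dotProduct, smul_eq_mul]
      generalize (fun i => (v i : ℤ)) ⬝ᵥ T *ᵥ (fun i => (v i : ℤ)) = q
      generalize (fun i => (v i : ℤ)) ⬝ᵥ b = u
      generalize c ⬝ᵥ (T + Tᵀ) *ᵥ (fun i => (v i : ℤ)) = e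
      generalize c ⬝ᵥ T *ᵥ c = e'
      have htν : (p : ℤ) ^ t ∣ (p : ℤ) ^ ν := pow_dvd_pow _ (by omega)
      refine and_congr ?_ ?_
      · rw [show q + (p : ℤ) ^ ν * e + (p : ℤ) ^ ν * (p : ℤ) ^ ν * e'
          = q + (p : ℤ) ^ ν * (e + (p : ℤ) ^ ν * e') by ring]
        exact dvd_add_left (htν.mul_right _)
      · rw [show a * (q + (p : ℤ) ^ ν * e + (p : ℤ) ^ ν * (p : ℤ) ^ ν * e')
            - (u + (p : ℤ) ^ ν * (c ⬝ᵥ b)) + d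
          = a * q - u + d + (p : ℤ) ^ ν * (a * e + a * (p : ℤ) ^ ν * e' - c ⬝ᵥ b) by ring]
        exact dvd_add_left (dvd_mul_right _ _)
  · ext i
    have h := congrArg (Int.cast : ℤ → ZMod (p ^ (ν + 1))) (congrFun hy i)
    simpa [dotProduct, mulVec, hT', hb', hy'] using h
  · rw [hD]
    simp [dotProduct, hb', hy']
  · intro h
    have h' : (((p : ℤ) ^ (ν - r) * D : ℤ) : ZMod (p ^ (ν + 1))) = 0 := by push_cast; exact h
    rw [ZMod.intCast_zmod_eq_zero_iff_dvd] at h'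
    push_cast at h'
    rw [show ν + 1 = (ν - r) + (r + 1) by omega, pow_add] at h'
    exact hDr ((mul_dvd_mul_iff_left (pow_ne_zero _ (by exact_mod_cast hp.ne_zero))).1 h')

/-- An even symmetric integral matrix is `T + Tᵀ` for an integral matrix `T`. -/
theorem exists_add_transpose_of_even {n : ℕ} {S : Matrix (Fin n) (Fin n) ℤ} (hsymm : S.IsSymm)
    (heven : ∀ v : Fin n → ℤ, 2 ∣ v ⬝ᵥ S.mulVec v) :
    ∃ T : Matrix (Fin n) (Fin n) ℤ, T + Tᵀ = S := by
  refine ⟨.of fun i j => if i < j then S i j else if i = j then S i i / 2 else 0, ?_⟩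
  ext i j
  have hij := hsymm.apply i j
  have hi := heven (Pi.single i 1)
  simp only [single_dotProduct, mulVec_single, one_mul, MulOpposite.op_one, one_smul, col_apply]
    at hi
  simp only [Matrix.add_apply, transpose_apply, of_apply]
  rcases lt_trichotomy i j with h | rfl | h
  · simp [h, h.not_gt, h.ne']
  · simp only [lt_irrefl, if_false, if_true]
    omega
  · simp [h, h.not_gt, h.ne', hij]

theorem ordv_spec {m : ℕ} (v : Fin m → ℚ) :
    0 < ordv v ∧ ∀ i, ∃ z : ℤ, (ordv v : ℚ) * v i = (z : ℚ) := by
  refine Nat.sInf_mem (s := {N : ℕ | 0 < N ∧ ∀ i, ∃ z : ℤ, (N : ℚ) * v i = (z : ℚ)})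
    ⟨∏ i, (v i).den, Finset.prod_pos fun i _ => (v i).pos, fun i => ?_⟩
  obtain ⟨c, hc⟩ := Finset.dvd_prod_of_mem (fun i => (v i).den) (Finset.mem_univ i)
  refine ⟨c * (v i).num, ?_⟩
  rw [hc]
  push_cast
  rw [← Rat.mul_den_eq_num]
  ring

theorem vmid_asmVec (n : ℕ) (l : ℚ) (μ : Fin n → ℚ) (m : ℚ) : vmid (asmVec n l μ m) = μ := by
  ext i
  have := i.isLt
  simp [vmid, asmVec, this.ne]

theorem hyp_mulVec_mid {m : ℕ} (A : Matrix (Fin m) (Fin m) ℤ) (g : Fin (m + 2) → ℚ) (i : Fin m) :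
    ((hyp A).map (Int.cast : ℤ → ℚ) *ᵥ g) ⟨i + 1, by omega⟩
      = (A.map (Int.cast : ℤ → ℚ) *ᵥ vmid g) i := by
  have := i.isLt
  simp only [mulVec, dotProduct, Fin.sum_univ_succ (n := m + 1), Fin.sum_univ_castSucc (n := m)]
  have hk : ∀ k : Fin m, (k : ℕ) ≠ m := fun k => k.isLt.ne
  simp [hyp, vmid, hk]
  rfl

theorem bilin_hyp {m : ℕ} (A : Matrix (Fin m) (Fin m) ℤ) (g : Fin (m + 2) → ℚ) :
    bilin ℚ (hyp A) g g = 2 * (g ⟨0, by omega⟩ * g ⟨m + 1, by omega⟩)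
      + bilin ℚ A (vmid g) (vmid g) := by
  have hk : ∀ k : Fin m, (k : ℕ) ≠ m := fun k => k.isLt.ne
  simp only [bilin, mulVec, dotProduct, Fin.sum_univ_succ (n := m + 1),
    Fin.sum_univ_castSucc (n := m)]
  simp [hyp, vmid, hk]
  change g 0 * g (Fin.last (m + 1)) + (∑ x : Fin m, g x.castSucc.succ *
      ∑ y : Fin m, (A x y : ℚ) * g y.castSucc.succ + g (Fin.last (m + 1)) * g 0)
    = 2 * (g 0 * g (Fin.last (m + 1))) + ∑ x : Fin m, g x.castSucc.succ *
      ∑ y : Fin m, (A x y : ℚ) * g y.castSucc.succ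
  ring

theorem quadF_ratCast {m : ℕ} (A : Matrix (Fin m) (Fin m) ℤ) (v : Fin m → ℚ) :
    quadF ℝ A (fun i => (v i : ℝ)) = ((quadF ℚ A v : ℚ) : ℝ) := by
  simp [quadF, bilin, dotProduct, mulVec]

/-- eventual geometric growth of `N*(λ,p^ν)`:
`N*(λ,p^{ν+1}) = p^{n−1} N*(λ,p^ν)` for `ν ≥ w_p = 1 + 2ν_p(2ℓ_λQ₀(λ))`. -/
theorem representation_number_stability
    (n : ℕ) (hn : 1 ≤ n) (S : Matrix (Fin n) (Fin n) ℤ)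
    (hsymm : S.IsSymm)
    (hpos : ∀ v : Fin n → ℝ, v ≠ 0 → 0 < bilin ℝ S v v)
    (heven : ∀ v : Fin n → ℤ, 2 ∣ v ⬝ᵥ S.mulVec v)
    (p : ℕ) (hp : p.Prime) (hmax : pMaximal n S p)
    (l : ℤ) (μ : Fin n → ℚ) (hμ : inDual S μ) (m : ℤ)
    (lam : Fin (n + 2) → ℚ) (hlamdef : lam = asmVec n (l : ℚ) μ (m : ℚ))
    (hlampos : (fun i => ((lam i : ℚ) : ℝ)) ∈ PosCone n S)
    (νl : ℕ)
    (hνl : νl = padicValNat p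
      (ratGcd (((MatS0 n S).map (Int.cast : ℤ → ℚ)).mulVec lam)))
    (hνlm : νl = padicValInt p m)
    (wp : ℤ)
    (hwp : wp = 1 + 2 * padicValRat p
      ((2 : ℚ) * (ordv lam : ℚ) * quadF ℚ (MatS0 n S) lam))
    (ν : ℕ) (hν : wp ≤ (ν : ℤ)) :
    Nstar n S lam p νl (ν + 1) = p ^ (n - 1) * Nstar n S lam p νl ν := by
  obtain ⟨T, hT⟩ := exists_add_transpose_of_even hsymm heven
  obtain ⟨hℓpos, hℓ⟩ := ordv_spec lam
  set ℓ := ordv lam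
  have hmid : vmid lam = μ := hlamdef ▸ vmid_asmVec n l μ m
  have h0 : lam ⟨0, by omega⟩ = l := by simp [hlamdef, asmVec]
  have hlast : lam ⟨n + 1, by omega⟩ = m := by simp [hlamdef, asmVec]
  choose b hb using hμ
  have hy : ∀ i, ∃ z : ℤ, (ℓ : ℚ) * μ i = z := fun i => by
    rw [← hmid]
    exact hℓ _
  choose y hy using hy
  have hSμ : S.map (Int.cast : ℤ → ℚ) *ᵥ μ = fun i => (b i : ℚ) := funext hb
  have hℓμ : (ℓ : ℚ) • μ = fun i => (y i : ℚ) := funext hy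
  have hSy : (T + Tᵀ) *ᵥ y = (ℓ : ℤ) • b := by
    ext i
    have h : (S.map (Int.cast : ℤ → ℚ) *ᵥ ((ℓ : ℚ) • μ)) i = ℓ * b i := by
      rw [mulVec_smul, hSμ, Pi.smul_apply, smul_eq_mul]
    rw [hℓμ] at h
    rw [hT]
    simp only [mulVec, dotProduct, Matrix.map_apply, Pi.smul_apply, smul_eq_mul] at h ⊢
    exact_mod_cast h
  set D : ℤ := 2 * ℓ * (l * m) - y ⬝ᵥ b with hD
  have hDQ : (2 : ℚ) * ℓ * quadF ℚ (MatS0 n S) lam = D := by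
    have h : (ℓ : ℚ) * bilin ℚ S μ μ = ((y ⬝ᵥ b : ℤ) : ℚ) := by
      rw [bilin, hSμ, ← smul_eq_mul, ← smul_dotProduct, hℓμ]
      simp [dotProduct]
    have hneg : bilin ℚ (-S) μ μ = -bilin ℚ S μ μ := by
      simp [bilin, dotProduct, mulVec]
    rw [quadF, MatS0, bilin_hyp, hmid, h0, hlast, hneg, hD]
    push_cast [← h]
    ring
  have hD0 : D ≠ 0 := by
    have hQ : 0 < quadF ℚ (MatS0 n S) lam := by
      have := hlampos.1
      rw [quadF_ratCast] at this
      exact_mod_cast this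
    have hD' : (0 : ℚ) < D := by
      rw [← hDQ]
      positivity
    exact_mod_cast hD'.ne'
  have := Fact.mk hp
  set r := padicValInt p D with hr
  rw [hDQ, padicValRat.of_int] at hwp
  have hνr : 2 * r + 1 ≤ ν := by omega
  have hm : (p : ℤ) ^ νl ∣ m := hνlm ▸ padicValInt_dvd m
  have hbdvd : ∀ i, (p : ℤ) ^ νl ∣ b i := fun i => by
    have h1 : p ^ νl ∣ ratGcd ((MatS0 n S).map (Int.cast : ℤ → ℚ) *ᵥ lam) :=
      hνl ▸ pow_padicValNat_dvd
    have h2 := h1.trans (Finset.gcd_dvd (Finset.mem_univ (⟨i + 1, by omega⟩ : Fin (n + 2))))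
    have hneg : ((-S).map (Int.cast : ℤ → ℚ) *ᵥ μ) i = ((-b i : ℤ) : ℚ) := by
      have := hb i
      simp only [mulVec, dotProduct, Matrix.map_apply, Matrix.neg_apply] at this ⊢
      push_cast
      rw [← this, ← Finset.sum_neg_distrib]
      exact Finset.sum_congr rfl fun _ _ => by ring
    rw [MatS0, hyp_mulVec_mid, hmid, hneg, Rat.num_intCast, Int.natAbs_neg] at h2
    exact_mod_cast Int.natCast_dvd.2 h2
  have hνlr : νl ≤ r := by
    have h : (p : ℤ) ^ νl ∣ D := by
      refine dvd_sub ((hm.mul_left l).mul_left _) (Finset.dvd_sum fun i _ => ?_)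
      exact (hbdvd i).mul_left _
    exact ((padicValInt_dvd_iff νl D).1 h).resolve_left hD0
  have hDr : ¬ (p : ℤ) ^ (r + 1) ∣ D := fun h => by
    have := ((padicValInt_dvd_iff (r + 1) D).1 h).resolve_left hD0
    omega
  obtain ⟨m', hm'⟩ := hm
  have hquad : ∀ v : Fin n → ℕ, quadF ℚ S (fun i => (v i : ℚ))
      = (((fun i => (v i : ℤ)) ⬝ᵥ T *ᵥ (fun i => (v i : ℤ)) : ℤ) : ℚ) := fun v => by
    have h1 : (fun i => (v i : ℤ)) ⬝ᵥ S *ᵥ (fun i => (v i : ℤ))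
        = 2 * ((fun i => (v i : ℤ)) ⬝ᵥ T *ᵥ (fun i => (v i : ℤ))) := by
      rw [← hT, add_mulVec, dotProduct_add, mulVec_transpose, dotProduct_comm _ (_ ᵥ* T),
        ← dotProduct_mulVec]
      ring
    have h2 : bilin ℚ S (fun i => (v i : ℚ)) (fun i => (v i : ℚ))
        = (((fun i => (v i : ℤ)) ⬝ᵥ S *ᵥ (fun i => (v i : ℤ)) : ℤ) : ℚ) := by
      simp [bilin, dotProduct, mulVec]
    rw [quadF, h2, h1]
    push_cast
    ring
  have hlin : ∀ v : Fin n → ℕ, bilin ℚ S (fun i => (v i : ℚ)) (vmid lam)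
      = (((fun i => (v i : ℤ)) ⬝ᵥ b : ℤ) : ℚ) := fun v => by
    rw [hmid, bilin, hSμ]
    simp [dotProduct]
  have hp0 : (p : ℚ) ≠ 0 := by exact_mod_cast hp.ne_zero
  rw [Nstar, Nstar, min_eq_right (by omega), min_eq_right (by omega), Finset.mul_sum]
  refine Finset.sum_congr rfl fun t ht => ?_
  have htl : t ≤ νl := Nat.lt_succ_iff.1 (Finset.mem_range.1 ht)
  classical
  have hsucc := card_box_quadratic_succ hn hp hνr (htl.trans hνlr) T b y ((p : ℤ) ^ (νl - t))
    (p ^ t * l * m') ℓ D hSy ?_ hDr (fun k v =>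
      (∃ e : ℤ, quadF ℚ S (fun i => (v i : ℚ)) = (p : ℚ) ^ t * e) ∧
      (∃ e : ℤ, (p : ℚ) ^ ((νl : ℤ) - (t : ℤ)) * quadF ℚ S (fun i => (v i : ℚ))
          - bilin ℚ S (fun i => (v i : ℚ)) (vmid lam)
          + (p : ℚ) ^ ((t : ℤ) - (νl : ℤ)) * lam ⟨0, by omega⟩ * lam ⟨n + 1, by omega⟩
        = (p : ℚ) ^ k * e)) fun k v => ?_
  · simp only [Ncount]
    convert hsucc
  · rw [hD, hm']
    nth_rewrite 1 [← Nat.sub_add_cancel htl]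
    ring
  · have e1 : (p : ℚ) ^ ((νl : ℤ) - (t : ℤ)) = (p : ℚ) ^ (νl - t) := by
      rw [← Nat.cast_sub htl, zpow_natCast]
    have e2 : (p : ℚ) ^ ((t : ℤ) - (νl : ℤ)) * l * m = (p : ℚ) ^ t * l * m' := by
      rw [zpow_sub₀ hp0, zpow_natCast, zpow_natCast, hm']
      push_cast
      field_simp
    rw [h0, hlast, e1, e2, hquad, hlin]
    refine and_congr (exists_congr fun e => ?_) (exists_congr fun e => ?_)
    · exact_mod_cast Iff.rfl
    · exact_mod_cast Iff.rfl
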